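/- (Simultaneous Cyclic Sliding Theorem, existence form) Let G be a Garside group, r a natural number, p, q ∈ ℤ^r, and a ∈ [p,q]. Let i ∈ {1,…,r} and let (p', q') be either (p + e_i, q) or (p, q − e_i), where e_i is the i-th standard basis vector of ℤ^r. If some conjugate of a lies in [p',q'] (i.e., a^G ∩ [p',q'] ≠ ∅), then there exist m ≤ ‖Δ‖ − 1 and simple elements x₁, …, x_m ∈ S such that, with y := x_m ⋯ x₂ x₁, we have y a y⁻¹ = a^{y⁻¹} ∈ [p',q']. -/

import Mathlib

/-- A Garside structure on a group `G`: a submonoid `G⁺` of positive elements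
together with a Garside element `Δ`, satisfying the Garside axioms. -/
structure GarsideStructure (G : Type*) [Group G] where
  /-- the monoid `G⁺` of positive elements -/
  pos : Submonoid G
  /-- the Garside element `Δ` -/
  Δ : G
  delta_mem : Δ ∈ pos
  /-- `G⁺` is Noetherian -/
  noetherian : ∀ a ∈ pos, ∃ n : ℕ, ∀ l : List G,
    (∀ x ∈ l, x ∈ pos ∧ x ≠ 1) → l.prod = a → l.length ≤ n
  /-- any two elements of `G⁺` admit a least common right multiple (w.r.t. `≼`) -/
  lcm_right : ∀ a ∈ pos, ∀ b ∈ pos, ∃ m ∈ pos,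
    a⁻¹ * m ∈ pos ∧ b⁻¹ * m ∈ pos ∧
      ∀ c ∈ pos, a⁻¹ * c ∈ pos → b⁻¹ * c ∈ pos → m⁻¹ * c ∈ pos
  /-- any two elements of `G⁺` admit a least common left multiple (w.r.t. `≽`) -/
  lcm_left : ∀ a ∈ pos, ∀ b ∈ pos, ∃ m ∈ pos,
    m * a⁻¹ ∈ pos ∧ m * b⁻¹ ∈ pos ∧
      ∀ c ∈ pos, c * a⁻¹ ∈ pos → c * b⁻¹ ∈ pos → c * m⁻¹ ∈ pos
  /-- `G` is the group of fractions of `G⁺` -/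
  fractions : ∀ g : G, ∃ a ∈ pos, ∃ b ∈ pos, g = a⁻¹ * b
  /-- `Δ` is balanced: its left divisors in `G⁺` coincide with its right divisors -/
  balanced : ∀ s ∈ pos, (s⁻¹ * Δ ∈ pos ↔ Δ * s⁻¹ ∈ pos)
  /-- the set of simple elements (divisors of `Δ`) is finite -/
  simples_finite : {s : G | s ∈ pos ∧ s⁻¹ * Δ ∈ pos}.Finite
  /-- the simple elements generate `G⁺` -/
  simples_generate : Submonoid.closure {s : G | s ∈ pos ∧ s⁻¹ * Δ ∈ pos} = pos

namespace GarsideStructure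

variable {G : Type*} [Group G]

/-- `a ≼ b` : left divisibility. -/
def LeftDvd (Γ : GarsideStructure G) (a b : G) : Prop := a⁻¹ * b ∈ Γ.pos

/-- `b ≽ a` : right divisibility. -/
def RightDvd (Γ : GarsideStructure G) (b a : G) : Prop := b * a⁻¹ ∈ Γ.pos

/-- a simple element: a divisor of `Δ`. -/
def Simple (Γ : GarsideStructure G) (s : G) : Prop := s ∈ Γ.pos ∧ Γ.LeftDvd s Γ.Δ

/-- an atom of `G⁺`. -/
def Atom (Γ : GarsideStructure G) (a : G) : Prop :=
  a ∈ Γ.pos ∧ a ≠ 1 ∧ ∀ b ∈ Γ.pos, ∀ c ∈ Γ.pos, a = b * c → b = 1 ∨ c = 1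

/-- the iterated automorphism `τ^k`, where `τ(x) = Δ⁻¹xΔ`; so `τ^k(x) = Δ^(-k) x Δ^k`. -/
def tau (Γ : GarsideStructure G) (k : ℤ) (x : G) : G := Γ.Δ ^ (-k) * x * Γ.Δ ^ k

/-- `d` is the greatest common left divisor (`∧`) of `a` and `b`. -/
def IsLeftGcd (Γ : GarsideStructure G) (d a b : G) : Prop :=
  d ∈ Γ.pos ∧ Γ.LeftDvd d a ∧ Γ.LeftDvd d b ∧
    ∀ c ∈ Γ.pos, Γ.LeftDvd c a → Γ.LeftDvd c b → Γ.LeftDvd c d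

/-- `d` is the greatest common right divisor (`⋀̃`) of `a` and `b`. -/
def IsRightGcd (Γ : GarsideStructure G) (d a b : G) : Prop :=
  d ∈ Γ.pos ∧ Γ.RightDvd a d ∧ Γ.RightDvd b d ∧
    ∀ c ∈ Γ.pos, Γ.RightDvd a c → Γ.RightDvd b c → Γ.RightDvd d c

/-- membership of a tuple `a ∈ Gʳ` in the interval `[p,q]`:
`pᵢ ≤ inf aᵢ` (i.e. `Δ^pᵢ ≼ aᵢ`) and `sup aᵢ ≤ qᵢ` (i.e. `aᵢ ≼ Δ^qᵢ`) for all `i`. -/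
def InInterval (Γ : GarsideStructure G) {r : ℕ} (p q : Fin r → ℤ) (a : Fin r → G) : Prop :=
  ∀ i, Γ.LeftDvd (Γ.Δ ^ (p i)) (a i) ∧ Γ.LeftDvd (a i) (Γ.Δ ^ (q i))

/-- `‖a‖`: the maximal number of atoms in an expression of `a` as a product of atoms. -/
noncomputable def anorm (Γ : GarsideStructure G) (a : G) : ℕ :=
  sSup {n | ∃ l : List G, (∀ x ∈ l, Γ.Atom x) ∧ l.prod = a ∧ l.length = n}

end GarsideStructure

namespace GarsideStructure

section Helpers

variable {G : Type*} [Group G] (Γ : GarsideStructure G)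

/-- lengths of factorizations into non-identity positive elements -/
def lenSet (a : G) : Set ℕ :=
  {n | ∃ l : List G, (∀ x ∈ l, x ∈ Γ.pos ∧ x ≠ 1) ∧ l.prod = a ∧ l.length = n}

/-- the maximal length of a factorization -/
noncomputable def len (a : G) : ℕ := sSup (Γ.lenSet a)

theorem lenSet_bdd {a : G} (ha : a ∈ Γ.pos) : BddAbove (Γ.lenSet a) := by
  obtain ⟨n, hn⟩ := Γ.noetherian a ha
  refine ⟨n, ?_⟩
  rintro k ⟨l, h1, h2, rfl⟩
  exact hn l h1 h2

theorem lenSet_nonempty {a : G} (ha : a ∈ Γ.pos) : (Γ.lenSet a).Nonempty := by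
  by_cases h : a = 1
  · exact ⟨0, [], by simp, by simp [h], rfl⟩
  · exact ⟨1, [a], by simp [h, ha], by simp, rfl⟩

theorem len_spec {a : G} (ha : a ∈ Γ.pos) :
    ∃ l : List G, (∀ x ∈ l, x ∈ Γ.pos ∧ x ≠ 1) ∧ l.prod = a ∧ l.length = Γ.len a :=
  Nat.sSup_mem (Γ.lenSet_nonempty ha) (Γ.lenSet_bdd ha)

theorem le_len {l : List G} (h : ∀ x ∈ l, x ∈ Γ.pos ∧ x ≠ 1) : l.length ≤ Γ.len l.prod :=
  le_csSup (Γ.lenSet_bdd (Submonoid.list_prod_mem _ fun x hx => (h x hx).1)) ⟨l, h, rfl, rfl⟩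

theorem len_mul {a b : G} (ha : a ∈ Γ.pos) (hb : b ∈ Γ.pos) :
    Γ.len a + Γ.len b ≤ Γ.len (a * b) := by
  obtain ⟨l, h1, h2, h3⟩ := Γ.len_spec ha
  obtain ⟨l', h1', h2', h3'⟩ := Γ.len_spec hb
  have := Γ.le_len (l := l ++ l') (by
    intro x hx
    rcases List.mem_append.1 hx with hx | hx
    · exact h1 x hx
    · exact h1' x hx)
  simpa [h2, h2', h3, h3'] using this

theorem len_pos {a : G} (ha : a ∈ Γ.pos) (h : a ≠ 1) : 1 ≤ Γ.len a := by
  have := Γ.le_len (l := [a]) (by simp [h, ha])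
  simpa using this

theorem len_one : Γ.len 1 = 0 := by
  have := Γ.len_mul Γ.pos.one_mem Γ.pos.one_mem
  simp at this
  exact this

theorem len_le_anorm {a : G} (ha : a ∈ Γ.pos) : Γ.len a ≤ Γ.anorm a := by
  obtain ⟨l, h1, h2, h3⟩ := Γ.len_spec ha
  apply le_csSup
  · obtain ⟨n, hn⟩ := Γ.noetherian a ha
    refine ⟨n, ?_⟩
    rintro k ⟨l, h1, h2, rfl⟩
    exact hn l (fun x hx => ⟨(h1 x hx).1, (h1 x hx).2.1⟩) h2
  · refine ⟨l, ?_, h2, h3⟩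
    intro x hx
    refine ⟨(h1 x hx).1, (h1 x hx).2, ?_⟩
    intro b hb c hc hbc
    by_contra hcon
    push Not at hcon
    obtain ⟨s, t, rfl⟩ := List.append_of_mem hx
    have := Γ.le_len (l := s ++ b :: c :: t) (by
      intro z hz
      simp only [List.mem_append, List.mem_cons] at hz
      rcases hz with hz | rfl | rfl | hz
      · exact h1 z (by simp [hz])
      · exact ⟨hb, hcon.1⟩
      · exact ⟨hc, hcon.2⟩
      · exact h1 z (by simp [hz]))
    have e : (s ++ b :: c :: t).prod = a := by
      rw [← h2]; simp [hbc, mul_assoc]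
    rw [e, ← h3] at this
    simp at this

theorem exists_mul_right (c : G) : ∃ b ∈ Γ.pos, c * b ∈ Γ.pos := by
  obtain ⟨a, ha, b, hb, rfl⟩ := Γ.fractions c
  obtain ⟨m, _, h1, h2, _⟩ := Γ.lcm_right a ha b hb
  exact ⟨b⁻¹ * m, h2, by simpa [mul_assoc] using h1⟩

theorem exists_mul_left (c : G) : ∃ b ∈ Γ.pos, b * c ∈ Γ.pos := by
  obtain ⟨a, ha, b, hb, rfl⟩ := Γ.fractions c
  exact ⟨a, ha, by simpa using hb⟩

theorem left_gcd_aux {a b : G} (ha : a ∈ Γ.pos) (hb : b ∈ Γ.pos) :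
    ∃ d, Γ.IsLeftGcd d a b := by
  let T : Set ℕ := {n | ∃ d ∈ Γ.pos, d⁻¹ * a ∈ Γ.pos ∧ d⁻¹ * b ∈ Γ.pos ∧ Γ.len d = n}
  have hT : T.Nonempty := ⟨_, 1, Γ.pos.one_mem, by simpa, by simpa, rfl⟩
  have hB : BddAbove T := by
    refine ⟨Γ.len a, ?_⟩
    rintro n ⟨d, hd, h1, _, rfl⟩
    have := Γ.len_mul hd h1
    simp at this
    omega
  obtain ⟨d, hd, h1, h2, h3⟩ := Nat.sSup_mem hT hB
  refine ⟨d, hd, h1, h2, ?_⟩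
  intro c hc hca hcb
  obtain ⟨m, hm, hcm, hdm, hmin⟩ := Γ.lcm_right c hc d hd
  have hle : Γ.len m ≤ Γ.len d := by
    rw [h3]
    exact le_csSup hB ⟨m, hm, hmin a ha hca h1, hmin b hb hcb h2, rfl⟩
  have : d⁻¹ * m = 1 := by
    by_contra hne
    have h4 := Γ.len_mul hd hdm
    have h5 := Γ.len_pos hdm hne
    simp at h4
    omega
  have e : d = m := by rwa [inv_mul_eq_one] at this
  rw [e]; exact hcm

theorem right_gcd_aux {a b : G} (ha : a ∈ Γ.pos) (hb : b ∈ Γ.pos) :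
    ∃ d, Γ.IsRightGcd d a b := by
  let T : Set ℕ := {n | ∃ d ∈ Γ.pos, a * d⁻¹ ∈ Γ.pos ∧ b * d⁻¹ ∈ Γ.pos ∧ Γ.len d = n}
  have hT : T.Nonempty := ⟨_, 1, Γ.pos.one_mem, by simpa, by simpa, rfl⟩
  have hB : BddAbove T := by
    refine ⟨Γ.len a, ?_⟩
    rintro n ⟨d, hd, h1, _, rfl⟩
    have := Γ.len_mul h1 hd
    simp at this
    omega
  obtain ⟨d, hd, h1, h2, h3⟩ := Nat.sSup_mem hT hB
  refine ⟨d, hd, h1, h2, ?_⟩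
  intro c hc hca hcb
  obtain ⟨m, hm, hcm, hdm, hmin⟩ := Γ.lcm_left c hc d hd
  have hle : Γ.len m ≤ Γ.len d := by
    rw [h3]
    exact le_csSup hB ⟨m, hm, hmin a ha hca h1, hmin b hb hcb h2, rfl⟩
  have : m * d⁻¹ = 1 := by
    by_contra hne
    have h4 := Γ.len_mul hdm hd
    have h5 := Γ.len_pos hdm hne
    simp at h4
    omega
  have e : m = d := by rwa [mul_inv_eq_one] at this
  rw [← e]; exact hcm

theorem left_gcd {a b : G} (ha : a ∈ Γ.pos) (hb : b ∈ Γ.pos) :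
    ∃ d ∈ Γ.pos, d⁻¹ * a ∈ Γ.pos ∧ d⁻¹ * b ∈ Γ.pos ∧
      ∀ c : G, c⁻¹ * a ∈ Γ.pos → c⁻¹ * b ∈ Γ.pos → c⁻¹ * d ∈ Γ.pos := by
  obtain ⟨d, hd, h1, h2, h3⟩ := Γ.left_gcd_aux ha hb
  refine ⟨d, hd, h1, h2, ?_⟩
  intro c hca hcb
  obtain ⟨t, ht, htc⟩ := Γ.exists_mul_left c
  obtain ⟨D, hD, k1, k2, k3⟩ := Γ.left_gcd_aux (Γ.pos.mul_mem ht ha) (Γ.pos.mul_mem ht hb)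
  have e1 : t⁻¹ * D ∈ Γ.pos := k3 t ht (by simpa [LeftDvd] using ha) (by simpa [LeftDvd] using hb)
  have e2 : (t * c)⁻¹ * D ∈ Γ.pos := k3 (t * c) htc
    (by simpa [LeftDvd, mul_assoc] using hca) (by simpa [LeftDvd, mul_assoc] using hcb)
  have e3 : (t⁻¹ * D)⁻¹ * d ∈ Γ.pos := h3 _ e1
    (by simpa [LeftDvd, mul_assoc] using k1) (by simpa [LeftDvd, mul_assoc] using k2)
  have := Γ.pos.mul_mem e2 e3
  simpa [mul_assoc] using this

theorem right_gcd {a b : G} (ha : a ∈ Γ.pos) (hb : b ∈ Γ.pos) :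
    ∃ d ∈ Γ.pos, a * d⁻¹ ∈ Γ.pos ∧ b * d⁻¹ ∈ Γ.pos ∧
      ∀ c : G, a * c⁻¹ ∈ Γ.pos → b * c⁻¹ ∈ Γ.pos → d * c⁻¹ ∈ Γ.pos := by
  obtain ⟨d, hd, h1, h2, h3⟩ := Γ.right_gcd_aux ha hb
  refine ⟨d, hd, h1, h2, ?_⟩
  intro c hca hcb
  obtain ⟨t, ht, htc⟩ := Γ.exists_mul_right c
  obtain ⟨D, hD, k1, k2, k3⟩ := Γ.right_gcd_aux (Γ.pos.mul_mem ha ht) (Γ.pos.mul_mem hb ht)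
  have e1 : D * t⁻¹ ∈ Γ.pos := k3 t ht (by simpa [RightDvd] using ha) (by simpa [RightDvd] using hb)
  have e2 : D * (c * t)⁻¹ ∈ Γ.pos := k3 (c * t) htc
    (by simpa [RightDvd, mul_assoc] using hca) (by simpa [RightDvd, mul_assoc] using hcb)
  have e3 : d * (D * t⁻¹)⁻¹ ∈ Γ.pos := h3 _ e1
    (by simpa [RightDvd, mul_assoc] using k1) (by simpa [RightDvd, mul_assoc] using k2)
  have := Γ.pos.mul_mem e3 e2
  simpa [mul_assoc] using this

theorem conj_inv {t : G} (ht : t ∈ Γ.pos) : Γ.Δ⁻¹ * t * Γ.Δ ∈ Γ.pos := by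
  rw [← Γ.simples_generate] at ht
  induction ht using Submonoid.closure_induction with
  | mem s hs =>
    obtain ⟨hs, h⟩ := hs
    have h2 : Γ.Δ * (s⁻¹ * Γ.Δ)⁻¹ ∈ Γ.pos := by simpa using hs
    have := (Γ.balanced _ h).2 h2
    simpa [mul_assoc] using this
  | one => simp
  | mul x y _ _ hx hy => simpa [mul_assoc] using Γ.pos.mul_mem hx hy

theorem conj_fwd {t : G} (ht : t ∈ Γ.pos) : Γ.Δ * t * Γ.Δ⁻¹ ∈ Γ.pos := by
  rw [← Γ.simples_generate] at ht
  induction ht using Submonoid.closure_induction with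
  | mem s hs =>
    obtain ⟨hs, h⟩ := hs
    have h := (Γ.balanced _ hs).1 h
    have h2 : (Γ.Δ * s⁻¹)⁻¹ * Γ.Δ ∈ Γ.pos := by simpa using hs
    have := (Γ.balanced _ h).1 h2
    simpa [mul_assoc] using this
  | one => simp
  | mul x y _ _ hx hy => simpa [mul_assoc] using Γ.pos.mul_mem hx hy

theorem cj {t : G} (ht : t ∈ Γ.pos) (n : ℤ) : Γ.Δ ^ n * t * (Γ.Δ ^ n)⁻¹ ∈ Γ.pos := by
  induction n using Int.induction_on with
  | zero => simpa
  | succ k ih =>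
    have := Γ.conj_fwd ih
    have e : Γ.Δ ^ ((k : ℤ) + 1) = Γ.Δ * Γ.Δ ^ (k : ℤ) := by rw [add_comm, zpow_one_add]
    rw [e]; simpa [mul_assoc] using this
  | pred k ih =>
    have := Γ.conj_inv ih
    have e : Γ.Δ ^ (-(k : ℤ) - 1) = Γ.Δ⁻¹ * Γ.Δ ^ (-(k : ℤ)) := by
      rw [sub_eq_neg_add, zpow_add, zpow_neg_one]
    rw [e]; simpa [mul_assoc] using this

theorem cj' {t : G} (ht : t ∈ Γ.pos) (n : ℤ) : (Γ.Δ ^ n)⁻¹ * t * Γ.Δ ^ n ∈ Γ.pos := by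
  simpa using Γ.cj ht (-n)

theorem comm_iff (t : G) (n : ℤ) : (Γ.Δ ^ n)⁻¹ * t ∈ Γ.pos ↔ t * (Γ.Δ ^ n)⁻¹ ∈ Γ.pos := by
  constructor
  · intro h
    simpa using Γ.cj h n
  · intro h
    simpa [mul_assoc] using Γ.cj' h n

theorem dvd_delta_pow {t : G} (ht : t ∈ Γ.pos) : ∃ n : ℕ, Γ.Δ ^ (n : ℤ) * t⁻¹ ∈ Γ.pos := by
  rw [← Γ.simples_generate] at ht
  induction ht using Submonoid.closure_induction with
  | mem s hs => exact ⟨1, by simpa using (Γ.balanced _ hs.1).1 hs.2⟩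
  | one => exact ⟨0, by simp⟩
  | mul x y _ _ hx hy =>
    obtain ⟨n, hn⟩ := hx
    obtain ⟨m, hm⟩ := hy
    refine ⟨n + m, ?_⟩
    have := Γ.pos.mul_mem (Γ.cj hm n) hn
    push_cast
    rw [zpow_add]
    simpa [mul_assoc] using this

theorem exists_simple_dvd {t : G} (ht : t ∈ Γ.pos) (h1 : t ≠ 1) :
    ∃ s, s ≠ 1 ∧ Γ.Simple s ∧ s⁻¹ * t ∈ Γ.pos := by
  have ht' := ht
  rw [← Γ.simples_generate] at ht
  induction ht using Submonoid.closure_induction with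
  | mem s hs => exact ⟨s, h1, hs, by simp⟩
  | one => exact absurd rfl h1
  | mul x y hx hy ihx ihy =>
    rw [Γ.simples_generate] at hx hy
    by_cases hx1 : x = 1
    · subst hx1
      simp only [one_mul] at h1 ⊢
      exact ihy h1 hy
    · obtain ⟨s, a, b, c⟩ := ihx hx1 hx
      exact ⟨s, a, b, by simpa [mul_assoc] using Γ.pos.mul_mem c hy⟩

/-- `Δ^n` right-divides the conjugate of `g` by `y`. -/
def Cond (y g : G) (n : ℤ) : Prop := y * g * y⁻¹ * (Γ.Δ ^ n)⁻¹ ∈ Γ.pos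

theorem cond_mul (z y g : G) (n : ℤ) :
    Γ.Cond z (y * g * y⁻¹) n ↔ Γ.Cond (z * y) g n := by
  simp [Cond, mul_assoc]

theorem cond_delta {y g : G} {n : ℤ} (k : ℤ) (h : Γ.Cond y g n) :
    Γ.Cond (Γ.Δ ^ k * y) g n := by
  have := Γ.cj h k
  have e : (Γ.Δ ^ n)⁻¹ * (Γ.Δ ^ k)⁻¹ = (Γ.Δ ^ k)⁻¹ * (Γ.Δ ^ n)⁻¹ := by
    rw [← mul_inv_rev, ← mul_inv_rev, zpow_mul_comm]
  simp only [Cond, mul_inv_rev, mul_assoc] at this ⊢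
  rwa [e] at this

theorem main_induction {K : Type*} (P : K → ℤ) (k0 : K) (N : ℕ) :
    ∀ (g : K → G) (y R : G), y ∈ Γ.pos → (∀ k, Γ.Cond 1 (g k) (P k)) →
      (∀ k, Γ.Cond y (g k) (P k)) → Γ.Cond y (g k0) (P k0 + 1) →
      (∀ S ∈ Γ.pos, S⁻¹ * y ∈ Γ.pos → (∀ k, Γ.Cond (S⁻¹ * y) (g k) (P k)) →
        Γ.Cond (S⁻¹ * y) (g k0) (P k0 + 1) → S = 1) →
      R ∈ Γ.pos → R⁻¹ * Γ.Δ ∈ Γ.pos → R⁻¹ * y ∈ Γ.pos →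
      (∀ c : G, c⁻¹ * Γ.Δ ∈ Γ.pos → c⁻¹ * y ∈ Γ.pos → c⁻¹ * R ∈ Γ.pos) →
      Γ.len R = N →
      ∃ l : List G, l.length ≤ N ∧ (∀ x ∈ l, Γ.Simple x) ∧ l.reverse.prod = y := by
  induction N using Nat.strong_induction_on with
  | _ N ih =>
  intro g y R hy hg hyg hy0 hmin hR hRD hRy hRu hN
  by_cases hy1 : y = 1
  · exact ⟨[], by simp, by simp, by simp [hy1]⟩
  obtain ⟨x, hx, hyx, hDx, hxu⟩ := Γ.right_gcd hy Γ.delta_mem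
  -- x preserves the interval
  have hA : ∀ k, Γ.Cond x (g k) (P k) := by
    intro k
    have h := hxu (Γ.Δ ^ P k * x * (g k)⁻¹) (by
        have := Γ.pos.mul_mem (hyg k) (Γ.cj hyx (P k))
        simpa [mul_assoc] using this) (by
        have h1 := Γ.cond_delta 1 (hg k)
        have := Γ.pos.mul_mem h1 (Γ.cj hDx (P k))
        simpa [mul_assoc] using this)
    simpa [Cond, mul_assoc] using h
  have hB : x * g k0 * (Γ.Δ ^ (P k0 + 1))⁻¹ ∈ Γ.pos := by
    have h := hxu (Γ.Δ ^ (P k0 + 1) * (g k0)⁻¹) (by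
        have := Γ.pos.mul_mem hy0 (Γ.cj hy (P k0 + 1))
        simpa [mul_assoc] using this) (by
        have h1 := Γ.conj_fwd (hg k0)
        have e : Γ.Δ ^ (P k0 + 1) = Γ.Δ * Γ.Δ ^ P k0 := by rw [add_comm, zpow_one_add]
        rw [e]
        simpa [mul_assoc] using h1)
    simpa [mul_assoc] using h
  have hcD : ∀ (k : K) (n : ℤ), Γ.Cond y (g k) n →
      ((y * (g k) * y⁻¹)⁻¹ * R * Γ.Δ ^ n)⁻¹ * Γ.Δ ∈ Γ.pos := by
    intro k n h
    have h1 := Γ.pos.mul_mem (Γ.cj' hRD n) (Γ.cj' h (n + 1))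
    have e : Γ.Δ ^ (n + 1) = Γ.Δ * Γ.Δ ^ n := by rw [add_comm, zpow_one_add]
    have e' : Γ.Δ ^ (n + 1) = Γ.Δ ^ n * Γ.Δ := by rw [zpow_add_one]
    have e2 : (Γ.Δ ^ n)⁻¹ * Γ.Δ ^ (n + 1) = Γ.Δ := by rw [e']; simp
    have e3 : Γ.Δ ^ n * (Γ.Δ ^ (n + 1))⁻¹ = Γ.Δ⁻¹ := by rw [e]; simp
    have : ((y * (g k) * y⁻¹)⁻¹ * R * Γ.Δ ^ n)⁻¹ * Γ.Δ =
      (Γ.Δ ^ n)⁻¹ * (R⁻¹ * Γ.Δ) * Γ.Δ ^ n *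
        ((Γ.Δ ^ (n + 1))⁻¹ * (y * g k * y⁻¹ * (Γ.Δ ^ n)⁻¹) * Γ.Δ ^ (n + 1)) := by
      calc _ = (Γ.Δ ^ n)⁻¹ * (R⁻¹ * Γ.Δ) * Γ.Δ⁻¹ * (y * g k * y⁻¹) * Γ.Δ := by
              simp [mul_assoc]
        _ = (Γ.Δ ^ n)⁻¹ * (R⁻¹ * Γ.Δ) * (Γ.Δ ^ n * (Γ.Δ ^ (n + 1))⁻¹) * (y * g k * y⁻¹) *
              ((Γ.Δ ^ n)⁻¹ * Γ.Δ ^ (n + 1)) := by rw [e2, e3]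
        _ = _ := by simp only [mul_assoc]
    rw [this]
    exact h1
  have fin : ∀ (k : K) (n : ℤ), ((y * (g k) * y⁻¹)⁻¹ * R * Γ.Δ ^ n)⁻¹ * R ∈ Γ.pos →
      Γ.Cond (R⁻¹ * y) (g k) n := by
    intro k n h
    have := (Γ.comm_iff (R⁻¹ * y * g k * (R⁻¹ * y)⁻¹) n).1 (by simpa [mul_assoc] using h)
    exact this
  have hC : ∀ k, Γ.Cond (R⁻¹ * y) (g k) (P k) := by
    intro k
    apply fin
    apply hRu _ (hcD k _ (hyg k))
    have h1 : (Γ.Δ ^ P k)⁻¹ * g k ∈ Γ.pos :=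
      (Γ.comm_iff _ _).2 (by simpa [Cond] using hg k)
    have := Γ.pos.mul_mem (Γ.cj' hRy (P k)) h1
    simpa [mul_assoc] using this
  obtain ⟨R', hR', hR'D, hR'y, hR'u⟩ := Γ.left_gcd Γ.delta_mem hyx
  have hR'R : R'⁻¹ * R ∈ Γ.pos := by
    apply hRu _ hR'D
    simpa [mul_assoc] using Γ.pos.mul_mem hR'y hx
  have hne : R'⁻¹ * R ≠ 1 := by
    intro h
    have e : R' = R := by rwa [inv_mul_eq_one] at h
    subst e
    have hC0 : Γ.Cond (R'⁻¹ * y) (g k0) (P k0 + 1) := by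
      apply fin
      apply hRu _ (hcD k0 _ hy0)
      have h1 := (Γ.comm_iff _ _).2 hB
      have := Γ.pos.mul_mem (Γ.cj' hR'y (P k0 + 1)) h1
      simpa [mul_assoc] using this
    have hR1 : R' = 1 := hmin R' hR hRy hC hC0
    obtain ⟨s, hs1, hs, hsy⟩ := Γ.exists_simple_dvd hy hy1
    have hs' := hRu s hs.2 hsy
    rw [hR1] at hs'
    have h2 := Γ.len_mul hs.1 hs'
    have h3 := Γ.len_pos hs.1 hs1
    simp only [mul_one, mul_inv_cancel, Γ.len_one] at h2
    omega
  have hlt : Γ.len R' < N := by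
    have h2 := Γ.len_mul hR' hR'R
    have h3 := Γ.len_pos hR'R hne
    simp only [mul_inv_cancel_left] at h2
    omega
  have hyy : y * x⁻¹ * x = y := by simp
  obtain ⟨l, hl1, hl2, hl3⟩ := ih (Γ.len R') hlt (fun k => x * g k * x⁻¹) (y * x⁻¹) R' hyx
    (fun k => by simpa [Γ.cond_mul] using hA k)
    (fun k => by rw [Γ.cond_mul, hyy]; exact hyg k)
    (by rw [Γ.cond_mul, hyy]; exact hy0)
    (by
      intro S hS hSy h1 h2
      have e : S⁻¹ * (y * x⁻¹) * x = S⁻¹ * y := by simp [mul_assoc]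
      refine hmin S hS ?_ ?_ ?_
      · rw [← e]; exact Γ.pos.mul_mem hSy hx
      · intro k
        have := h1 k
        rwa [Γ.cond_mul, e] at this
      · rwa [Γ.cond_mul, e] at h2)
    hR' hR'D hR'y hR'u rfl
  refine ⟨x :: l, ?_, ?_, ?_⟩
  · simp only [List.length_cons]; omega
  · intro z hz
    rcases List.mem_cons.1 hz with rfl | hz
    · exact ⟨hx, (Γ.balanced _ hx).2 hDx⟩
    · exact hl2 z hz
  · simp [hl3]

theorem main_exists {K : Type*} (P : K → ℤ) (k0 : K) (g : K → G)
    (hg : ∀ k, Γ.Cond 1 (g k) (P k))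
    (hx : ∃ x : G, (∀ k, Γ.Cond x (g k) (P k)) ∧ Γ.Cond x (g k0) (P k0 + 1)) :
    ∃ l : List G, l.length ≤ Γ.anorm Γ.Δ - 1 ∧ (∀ x ∈ l, Γ.Simple x) ∧
      (∀ k, Γ.Cond l.reverse.prod (g k) (P k)) ∧
      Γ.Cond l.reverse.prod (g k0) (P k0 + 1) := by
  classical
  let T : ℕ → Prop := fun n => ∃ y ∈ Γ.pos, (∀ k, Γ.Cond y (g k) (P k)) ∧
    Γ.Cond y (g k0) (P k0 + 1) ∧ Γ.len y = n
  have hT : ∃ n, T n := by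
    obtain ⟨x, h1, h2⟩ := hx
    obtain ⟨a, ha, b, hb, rfl⟩ := Γ.fractions x
    obtain ⟨n, hn⟩ := Γ.dvd_delta_pow ha
    refine ⟨_, Γ.Δ ^ (n : ℤ) * (a⁻¹ * b), ?_, fun k => Γ.cond_delta _ (h1 k),
      Γ.cond_delta _ h2, rfl⟩
    simpa [mul_assoc] using Γ.pos.mul_mem hn hb
  obtain ⟨y, hy, h1, h2, h3⟩ := Nat.find_spec hT
  have hmin : ∀ S ∈ Γ.pos, S⁻¹ * y ∈ Γ.pos → (∀ k, Γ.Cond (S⁻¹ * y) (g k) (P k)) →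
        Γ.Cond (S⁻¹ * y) (g k0) (P k0 + 1) → S = 1 := by
    intro S hS hSy k1 k2
    by_contra hne
    have h4 : Nat.find hT ≤ Γ.len (S⁻¹ * y) := Nat.find_min' hT ⟨_, hSy, k1, k2, rfl⟩
    have h5 := Γ.len_mul hS hSy
    have h6 := Γ.len_pos hS hne
    simp only [mul_inv_cancel_left] at h5
    omega
  obtain ⟨R, hR, hRD, hRy, hRu⟩ := Γ.left_gcd Γ.delta_mem hy
  obtain ⟨l, hl1, hl2, hl3⟩ :=
    Γ.main_induction P k0 (Γ.len R) g y R hy hg h1 h2 hmin hR hRD hRy hRu rfl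
  refine ⟨l, ?_, hl2, by rw [hl3]; exact h1, by rw [hl3]; exact h2⟩
  have h7 := Γ.len_le_anorm Γ.delta_mem
  have h8 := Γ.len_mul hR hRD
  simp only [mul_inv_cancel_left] at h8
  by_cases hRe : R⁻¹ * Γ.Δ = 1
  · have e : R = Γ.Δ := by rwa [inv_mul_eq_one] at hRe
    subst e
    have e1 : ∀ (n : ℤ) (k : K), Γ.Cond y (g k) n → Γ.Cond (Γ.Δ⁻¹ * y) (g k) n := by
      intro n k h
      simpa using Γ.cond_delta (-1) h
    have := hmin Γ.Δ hR hRy (fun k => e1 _ k (h1 k)) (e1 _ k0 h2)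
    rw [this, Γ.len_one] at hl1
    omega
  · have := Γ.len_pos hRD hRe
    omega

end Helpers

end GarsideStructure

/-- Simultaneous Cyclic Sliding Theorem (existence form): if `a ∈ [p,q]` and some
conjugate of `a` lies in the subinterval `[p',q']`, obtained from `[p,q]` by
increasing `pᵢ` by one or decreasing `qᵢ` by one, then there are `m ≤ ‖Δ‖ − 1`
simple elements `x₁, …, x_m` such that, with `y := x_m ⋯ x₂ x₁`,
`y a y⁻¹ = a^{y⁻¹} ∈ [p',q']`. -/
theorem simultaneous_cyclic_sliding {G : Type*} [Group G] (Γ : GarsideStructure G)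
    (r : ℕ) (p q : Fin r → ℤ) (a : Fin r → G) (ha : Γ.InInterval p q a)
    (i : Fin r) (p' q' : Fin r → ℤ)
    (htarget : (p' = Function.update p i (p i + 1) ∧ q' = q) ∨
               (p' = p ∧ q' = Function.update q i (q i - 1)))
    (hconj : ∃ x : G, Γ.InInterval p' q' (fun j => x⁻¹ * a j * x)) :
    ∃ m : ℕ, m ≤ Γ.anorm Γ.Δ - 1 ∧
      ∃ x : Fin m → G, (∀ j, Γ.Simple (x j)) ∧
        Γ.InInterval p' q'
          (fun j => (List.ofFn x).reverse.prod * a j * ((List.ofFn x).reverse.prod)⁻¹) := by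
  have key : ∀ (pp qq : Fin r → ℤ) (y : G),
      Γ.InInterval pp qq (fun j => y * a j * y⁻¹) ↔
      (∀ j, Γ.Cond y (a j) (pp j)) ∧ (∀ j, Γ.Cond y (a j)⁻¹ (-(qq j))) := by
    intro pp qq y
    unfold GarsideStructure.InInterval GarsideStructure.LeftDvd GarsideStructure.Cond
    rw [← forall_and]
    refine forall_congr' fun j => and_congr (Γ.comm_iff _ _) ?_
    simp [mul_assoc]
  let P : Fin r ⊕ Fin r → ℤ := Sum.elim p (fun j => -(q j))
  let g : Fin r ⊕ Fin r → G := Sum.elim a (fun j => (a j)⁻¹)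
  have hg : ∀ k, Γ.Cond 1 (g k) (P k) := by
    have := (key p q 1).1 (by simpa using ha)
    rintro (j | j)
    · exact this.1 j
    · exact this.2 j
  have mono : ∀ (y t : G) (n : ℤ), Γ.Cond y t (n + 1) → Γ.Cond y t n := by
    intro y t n h
    have := Γ.pos.mul_mem h Γ.delta_mem
    unfold GarsideStructure.Cond at h ⊢
    have e : (Γ.Δ ^ (n + 1))⁻¹ * Γ.Δ = (Γ.Δ ^ n)⁻¹ := by
      rw [add_comm, zpow_one_add]; simp
    rwa [mul_assoc, e] at this
  -- the target interval, in terms of `Cond`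
  obtain ⟨k0, hk0⟩ : ∃ k0 : Fin r ⊕ Fin r, ∀ y : G,
      Γ.InInterval p' q' (fun j => y * a j * y⁻¹) ↔
      (∀ k, Γ.Cond y (g k) (P k)) ∧ Γ.Cond y (g k0) (P k0 + 1) := by
    rcases htarget with ⟨rfl, rfl⟩ | ⟨rfl, rfl⟩
    · refine ⟨Sum.inl i, fun y => ?_⟩
      rw [key, Sum.forall]
      constructor
      · rintro ⟨h1, h2⟩
        have h0 := h1 i
        rw [Function.update_self] at h0
        refine ⟨⟨fun j => ?_, h2⟩, h0⟩
        by_cases hj : j = i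
        · subst hj; exact mono _ _ _ h0
        · have := h1 j
          rwa [Function.update_of_ne hj] at this
      · rintro ⟨⟨h1, h2⟩, h0⟩
        refine ⟨fun j => ?_, h2⟩
        by_cases hj : j = i
        · subst hj; rw [Function.update_self]; exact h0
        · rw [Function.update_of_ne hj]; exact h1 j
    · refine ⟨Sum.inr i, fun y => ?_⟩
      have e : -(q i - 1) = -(q i) + 1 := by ring
      rw [key, Sum.forall]
      constructor
      · rintro ⟨h1, h2⟩
        have h0 := h2 i
        rw [Function.update_self, e] at h0
        refine ⟨⟨h1, fun j => ?_⟩, h0⟩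
        by_cases hj : j = i
        · subst hj; exact mono _ _ _ h0
        · have := h2 j
          rwa [Function.update_of_ne hj] at this
      · rintro ⟨⟨h1, h2⟩, h0⟩
        refine ⟨h1, fun j => ?_⟩
        by_cases hj : j = i
        · subst hj; rw [Function.update_self, e]; exact h0
        · rw [Function.update_of_ne hj]; exact h2 j
  obtain ⟨x, hx⟩ := hconj
  obtain ⟨l, hl1, hl2, hl3⟩ := Γ.main_exists P k0 g hg ⟨x⁻¹, (hk0 _).1 (by simpa using hx)⟩
  refine ⟨l.length, hl1, l.get, fun j => hl2 _ (List.get_mem _ _), ?_⟩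
  rw [List.ofFn_get]
  exact (hk0 _).2 hl3
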